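/- arXiv:1808.03592 — 3 statements merged into one kernel-verified Lean document; each statement's English description precedes it below -/
import Mathlib

section
/- Define the MPC feedback u^MPC on F_N by u^MPC(x) = u*_N(x,0), the first element of the unique horizon-N optimal sequence at x. Let N ≥ 1 and x0 ∈ ℙ_N with extended optimal solution u*(k), x*(k). Then for every k ≥ 0, x*(k) ∈ ℙ_N and u*(k) = u^MPC(x*(k)); in particular the open-loop optimal input sequence coincides with the receding-horizon (MPC) input sequence along the trajectory, and ℙ_N is positive invariant under the MPC closed loop x(k+1) = A x(k) + B u^MPC(x(k)). -/
open Matrix Set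

noncomputable section

/-- State trajectory generated by dynamics `x(k+1) = A x(k) + B u(k)` from `x0`. -/
def traj {n m : ℕ} (A : Matrix (Fin n) (Fin n) ℝ) (B : Matrix (Fin n) (Fin m) ℝ)
    (x0 : Fin n → ℝ) (u : ℕ → Fin m → ℝ) : ℕ → Fin n → ℝ
  | 0 => x0
  | k + 1 => A *ᵥ traj A B x0 u k + B *ᵥ u k

/-- Feasibility of a control sequence for horizon `N` and initial state `x0`. -/
def Feasible {n m qX qU qT : ℕ} (A : Matrix (Fin n) (Fin n) ℝ) (B : Matrix (Fin n) (Fin m) ℝ)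
    (Cx : Matrix (Fin qX) (Fin n) ℝ) (cx : Fin qX → ℝ)
    (Cu : Matrix (Fin qU) (Fin m) ℝ) (cu : Fin qU → ℝ)
    (Ct : Matrix (Fin qT) (Fin n) ℝ) (ct : Fin qT → ℝ)
    (N : ℕ) (x0 : Fin n → ℝ) (u : ℕ → Fin m → ℝ) : Prop :=
  (∀ k < N, Cx *ᵥ traj A B x0 u k ≤ cx ∧ Cu *ᵥ u k ≤ cu) ∧
    Ct *ᵥ traj A B x0 u N ≤ ct

/-- The quadratic cost `J_N(x0, u)`. -/
def cost {n m : ℕ} (A : Matrix (Fin n) (Fin n) ℝ) (B : Matrix (Fin n) (Fin m) ℝ)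
    (Q : Matrix (Fin n) (Fin n) ℝ) (R : Matrix (Fin m) (Fin m) ℝ)
    (P : Matrix (Fin n) (Fin n) ℝ)
    (N : ℕ) (x0 : Fin n → ℝ) (u : ℕ → Fin m → ℝ) : ℝ :=
  (1 / 2) * (traj A B x0 u N ⬝ᵥ (P *ᵥ traj A B x0 u N)) +
    (1 / 2) * ∑ k ∈ Finset.range N,
      (traj A B x0 u k ⬝ᵥ (Q *ᵥ traj A B x0 u k) + u k ⬝ᵥ (R *ᵥ u k))

/-- `u` is an optimal (feasible, cost-minimizing) sequence for horizon `N` at `x0`. -/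
def IsOptimal {n m qX qU qT : ℕ} (A : Matrix (Fin n) (Fin n) ℝ) (B : Matrix (Fin n) (Fin m) ℝ)
    (Q : Matrix (Fin n) (Fin n) ℝ) (R : Matrix (Fin m) (Fin m) ℝ)
    (P : Matrix (Fin n) (Fin n) ℝ)
    (Cx : Matrix (Fin qX) (Fin n) ℝ) (cx : Fin qX → ℝ)
    (Cu : Matrix (Fin qU) (Fin m) ℝ) (cu : Fin qU → ℝ)
    (Ct : Matrix (Fin qT) (Fin n) ℝ) (ct : Fin qT → ℝ)
    (N : ℕ) (x0 : Fin n → ℝ) (u : ℕ → Fin m → ℝ) : Prop :=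
  Feasible A B Cx cx Cu cu Ct ct N x0 u ∧
    ∀ v, Feasible A B Cx cx Cu cu Ct ct N x0 v →
      cost A B Q R P N x0 u ≤ cost A B Q R P N x0 v

/-- The feasible set `F_N` of initial states. -/
def FeasSet {n m qX qU qT : ℕ} (A : Matrix (Fin n) (Fin n) ℝ) (B : Matrix (Fin n) (Fin m) ℝ)
    (Cx : Matrix (Fin qX) (Fin n) ℝ) (cx : Fin qX → ℝ)
    (Cu : Matrix (Fin qU) (Fin m) ℝ) (cu : Fin qU → ℝ)
    (Ct : Matrix (Fin qT) (Fin n) ℝ) (ct : Fin qT → ℝ)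
    (N : ℕ) : Set (Fin n → ℝ) :=
  {x0 | ∃ u, Feasible A B Cx cx Cu cu Ct ct N x0 u}

section Trajectories

variable {n m : ℕ} (A : Matrix (Fin n) (Fin n) ℝ) (B : Matrix (Fin n) (Fin m) ℝ)

theorem traj_shift (x : Fin n → ℝ) (v : ℕ → Fin m → ℝ) (k j : ℕ) :
    traj A B (traj A B x v k) (fun i => v (i + k)) j = traj A B x v (j + k) := by
  induction j with
  | zero => rw [Nat.zero_add, traj]
  | succ j ih => rw [traj, ih, Nat.add_right_comm, traj]

theorem traj_congr (x : Fin n → ℝ) {v w : ℕ → Fin m → ℝ} {N : ℕ} (h : ∀ k < N, v k = w k) :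
    ∀ k ≤ N, traj A B x v k = traj A B x w k := by
  intro k
  induction k with
  | zero => intro _; rfl
  | succ k ih => intro hk; rw [traj, traj, ih (by omega), h k (by omega)]

theorem traj_combo (x : Fin n → ℝ) (v w : ℕ → Fin m → ℝ) (t : ℝ) (k : ℕ) :
    traj A B x (fun j => v j + t • (w j - v j)) k =
      traj A B x v k + t • (traj A B x w k - traj A B x v k) := by
  induction k with
  | zero => simp [traj]
  | succ k ih =>
    simp only [traj, ih, mulVec_add, mulVec_smul, mulVec_sub]
    module

theorem traj_sub (x : Fin n → ℝ) (v w : ℕ → Fin m → ℝ) (k : ℕ) :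
    traj A B 0 (fun j => w j - v j) k = traj A B x w k - traj A B x v k := by
  induction k with
  | zero => simp [traj]
  | succ k ih =>
    simp only [traj, ih, mulVec_sub]
    module

end Trajectories

theorem quadForm_combo {ι : Type*} [Fintype ι] (M : Matrix ι ι ℝ) (a b : ι → ℝ) (t : ℝ) :
    (a + t • (b - a)) ⬝ᵥ (M *ᵥ (a + t • (b - a))) =
      (1 - t) * (a ⬝ᵥ (M *ᵥ a)) + t * (b ⬝ᵥ (M *ᵥ b)) -
        t * (1 - t) * ((b - a) ⬝ᵥ (M *ᵥ (b - a))) := by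
  simp only [mulVec_add, mulVec_smul, mulVec_sub, dotProduct_add, add_dotProduct,
    dotProduct_smul, smul_dotProduct, dotProduct_sub, sub_dotProduct, smul_eq_mul]
  ring

section Cost

variable {n m : ℕ} (A : Matrix (Fin n) (Fin n) ℝ) (B : Matrix (Fin n) (Fin m) ℝ)
  (Q : Matrix (Fin n) (Fin n) ℝ) (R : Matrix (Fin m) (Fin m) ℝ) (P : Matrix (Fin n) (Fin n) ℝ)

theorem cost_congr (x : Fin n → ℝ) {v w : ℕ → Fin m → ℝ} {N : ℕ} (h : ∀ k < N, v k = w k) :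
    cost A B Q R P N x v = cost A B Q R P N x w := by
  have ht := traj_congr A B x h
  unfold cost
  rw [ht N le_rfl]
  congr 2
  refine Finset.sum_congr rfl fun k hk => ?_
  have hk' := Finset.mem_range.1 hk
  rw [ht k hk'.le, h k hk']

theorem cost_combo (x : Fin n → ℝ) (v w : ℕ → Fin m → ℝ) (t : ℝ) (N : ℕ) :
    cost A B Q R P N x (fun j => v j + t • (w j - v j)) =
      (1 - t) * cost A B Q R P N x v + t * cost A B Q R P N x w -
        t * (1 - t) * cost A B Q R P N 0 (fun j => w j - v j) := by
  simp only [cost, traj_combo, traj_sub A B x, quadForm_combo]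
  simp only [Finset.sum_add_distrib, Finset.sum_sub_distrib, ← Finset.mul_sum]
  ring

theorem cost_succ_left (x : Fin n → ℝ) (v : ℕ → Fin m → ℝ) (N : ℕ) :
    cost A B Q R P (N + 1) x v =
      (1 / 2) * (x ⬝ᵥ (Q *ᵥ x) + v 0 ⬝ᵥ (R *ᵥ v 0)) +
        cost A B Q R P N (traj A B x v 1) (fun j => v (j + 1)) := by
  simp only [cost, traj_shift, Finset.sum_range_succ']
  simp only [traj]
  ring

theorem cost_succ_right (x : Fin n → ℝ) (v : ℕ → Fin m → ℝ) (N : ℕ) :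
    cost A B Q R P (N + 1) x v = cost A B Q R P N x v +
      (1 / 2) * (traj A B x v N ⬝ᵥ (Q *ᵥ traj A B x v N) + v N ⬝ᵥ (R *ᵥ v N) +
        traj A B x v (N + 1) ⬝ᵥ (P *ᵥ traj A B x v (N + 1)) -
        traj A B x v N ⬝ᵥ (P *ᵥ traj A B x v N)) := by
  simp only [cost, Finset.sum_range_succ]
  ring

variable {Q R P}

theorem half_sum_input_le_cost (hQ : Q.PosSemidef) (hP : P.PosSemidef)
    (x : Fin n → ℝ) (v : ℕ → Fin m → ℝ) (N : ℕ) :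
    (1 / 2) * ∑ k ∈ Finset.range N, v k ⬝ᵥ (R *ᵥ v k) ≤ cost A B Q R P N x v := by
  have h1 : 0 ≤ traj A B x v N ⬝ᵥ (P *ᵥ traj A B x v N) := by
    simpa using hP.dotProduct_mulVec_nonneg (traj A B x v N)
  have h2 : 0 ≤ ∑ k ∈ Finset.range N, traj A B x v k ⬝ᵥ (Q *ᵥ traj A B x v k) :=
    Finset.sum_nonneg fun k _ => by simpa using hQ.dotProduct_mulVec_nonneg (traj A B x v k)
  unfold cost
  rw [Finset.sum_add_distrib]
  linarith

theorem input_form_nonneg (hR : R.PosDef) (w : Fin m → ℝ) : 0 ≤ w ⬝ᵥ (R *ᵥ w) := by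
  simpa using hR.posSemidef.dotProduct_mulVec_nonneg w

theorem cost_nonneg (hQ : Q.PosSemidef) (hR : R.PosDef) (hP : P.PosSemidef)
    (x : Fin n → ℝ) (v : ℕ → Fin m → ℝ) (N : ℕ) : 0 ≤ cost A B Q R P N x v := by
  have h : 0 ≤ ∑ k ∈ Finset.range N, v k ⬝ᵥ (R *ᵥ v k) :=
    Finset.sum_nonneg fun k _ => input_form_nonneg hR (v k)
  linarith [half_sum_input_le_cost (R := R) A B hQ hP x v N]

theorem input_eq_zero_of_cost_nonpos (hQ : Q.PosSemidef) (hR : R.PosDef) (hP : P.PosSemidef)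
    {x : Fin n → ℝ} {v : ℕ → Fin m → ℝ} {N : ℕ} (h : cost A B Q R P N x v ≤ 0) :
    ∀ k < N, v k = 0 := by
  intro k hk
  by_contra hne
  have hpos : 0 < v k ⬝ᵥ (R *ᵥ v k) := by simpa using hR.dotProduct_mulVec_pos hne
  have hle := Finset.single_le_sum (f := fun k => v k ⬝ᵥ (R *ᵥ v k))
    (fun k _ => input_form_nonneg hR (v k)) (Finset.mem_range.2 hk)
  linarith [half_sum_input_le_cost (R := R) A B hQ hP x v N]

/-- Completion of squares for the discrete-time algebraic Riccati equation. -/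
theorem riccati_complete_square (hR : R.PosDef) (hP : P.PosSemidef)
    {K : Matrix (Fin m) (Fin n) ℝ} (hdet : IsUnit (R + Bᵀ * P * B).det)
    (hRic : P = Aᵀ * (P - P * B * (R + Bᵀ * P * B)⁻¹ * (Bᵀ * P)) * A + Q)
    (hK : K = -((Bᵀ * P * B + R)⁻¹ * (Bᵀ * P * A))) (x : Fin n → ℝ) (v : Fin m → ℝ) :
    x ⬝ᵥ (Q *ᵥ x) + v ⬝ᵥ (R *ᵥ v) + (A *ᵥ x + B *ᵥ v) ⬝ᵥ (P *ᵥ (A *ᵥ x + B *ᵥ v)) -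
        x ⬝ᵥ (P *ᵥ x) =
      (v - K *ᵥ x) ⬝ᵥ (R *ᵥ (v - K *ᵥ x)) +
        (B *ᵥ (v - K *ᵥ x)) ⬝ᵥ (P *ᵥ (B *ᵥ (v - K *ᵥ x))) := by
  have hsymm {ι : Type} [Fintype ι] {M : Matrix ι ι ℝ} (hM : Mᵀ = M) (a b : ι → ℝ) :
      a ⬝ᵥ (M *ᵥ b) = b ⬝ᵥ (M *ᵥ a) := by
    rw [dotProduct_mulVec, ← mulVec_transpose, hM, dotProduct_comm]
  have hPs := hsymm (M := P) (by simpa using hP.isHermitian.eq)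
  have hRs := hsymm (M := R) (by simpa using hR.isHermitian.eq)
  have hadj {ι κ : Type} [Fintype ι] [Fintype κ] (M : Matrix ι κ ℝ) (a : κ → ℝ) (b : ι → ℝ) :
      a ⬝ᵥ (Mᵀ *ᵥ b) = (M *ᵥ a) ⬝ᵥ b := by
    rw [dotProduct_comm, mulVec_transpose, ← dotProduct_mulVec, dotProduct_comm]
  rw [add_comm (Bᵀ * P * B) R] at hK
  have hSK : (R + Bᵀ * P * B) * K = -(Bᵀ * P * A) := by
    rw [hK, Matrix.mul_neg, Matrix.mul_nonsing_inv_cancel_left _ _ hdet]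
  have hgain (w : Fin m → ℝ) :
      w ⬝ᵥ (R *ᵥ (K *ᵥ x)) + (B *ᵥ w) ⬝ᵥ (P *ᵥ (B *ᵥ (K *ᵥ x))) =
        -((B *ᵥ w) ⬝ᵥ (P *ᵥ (A *ᵥ x))) := by
    have := congrArg (fun M => w ⬝ᵥ (M *ᵥ x)) hSK
    simpa only [Matrix.add_mul, add_mulVec, ← mulVec_mulVec, neg_mulVec, dotProduct_add,
      dotProduct_neg, hadj] using this
  have hPK : P = Aᵀ * P * A + Aᵀ * P * B * K + Q := by
    rw [hK]
    nth_rewrite 1 [hRic]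
    simp only [sub_eq_add_neg, Matrix.mul_add, Matrix.add_mul, Matrix.mul_neg,
      Matrix.neg_mul, Matrix.mul_assoc]
  have hPx : x ⬝ᵥ (P *ᵥ x) = (A *ᵥ x) ⬝ᵥ (P *ᵥ (A *ᵥ x)) +
      (A *ᵥ x) ⬝ᵥ (P *ᵥ (B *ᵥ (K *ᵥ x))) + x ⬝ᵥ (Q *ᵥ x) := by
    have := congrArg (fun M => x ⬝ᵥ (M *ᵥ x)) hPK
    simpa only [add_mulVec, ← mulVec_mulVec, dotProduct_add, hadj] using this
  have h1 := hgain v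
  have h2 := hgain (K *ᵥ x)
  simp only [mulVec_add, mulVec_sub, dotProduct_add, add_dotProduct, dotProduct_sub,
    sub_dotProduct]
  rw [hPs (A *ᵥ x) (B *ᵥ v), hRs (K *ᵥ x) v, hPs (B *ᵥ (K *ᵥ x)) (B *ᵥ v)]
  rw [hPs (A *ᵥ x) (B *ᵥ (K *ᵥ x))] at hPx
  linear_combination (-1 : ℝ) * hPx + 2 * h1 - h2

end Cost

section Optimality

variable {n m qX qU qT : ℕ} {A : Matrix (Fin n) (Fin n) ℝ} {B : Matrix (Fin n) (Fin m) ℝ}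
  {Q : Matrix (Fin n) (Fin n) ℝ} {R : Matrix (Fin m) (Fin m) ℝ} {P : Matrix (Fin n) (Fin n) ℝ}
  {Cx : Matrix (Fin qX) (Fin n) ℝ} {cx : Fin qX → ℝ}
  {Cu : Matrix (Fin qU) (Fin m) ℝ} {cu : Fin qU → ℝ}
  {Ct : Matrix (Fin qT) (Fin n) ℝ} {ct : Fin qT → ℝ}
  {N : ℕ} {x : Fin n → ℝ} {v w : ℕ → Fin m → ℝ}

theorem mulVec_combo_le {ι κ : Type*} [Fintype κ] (C : Matrix ι κ ℝ) {c : ι → ℝ} {a b : κ → ℝ}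
    {t : ℝ} (ht0 : 0 ≤ t) (ht1 : t ≤ 1) (ha : C *ᵥ a ≤ c) (hb : C *ᵥ b ≤ c) :
    C *ᵥ (a + t • (b - a)) ≤ c := by
  intro i
  have h1 := ha i
  have h2 := hb i
  simp only [mulVec_add, mulVec_smul, mulVec_sub, Pi.add_apply, Pi.smul_apply, Pi.sub_apply,
    smul_eq_mul]
  nlinarith [mul_le_mul_of_nonneg_left h2 ht0,
    mul_le_mul_of_nonneg_left h1 (sub_nonneg.2 ht1)]

theorem Feasible.congr (hv : Feasible A B Cx cx Cu cu Ct ct N x v) (h : ∀ k < N, w k = v k) :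
    Feasible A B Cx cx Cu cu Ct ct N x w := by
  have ht := traj_congr A B x h
  refine ⟨fun k hk => ?_, ?_⟩
  · rw [ht k hk.le, h k hk]
    exact hv.1 k hk
  · rw [ht N le_rfl]
    exact hv.2

theorem IsOptimal.congr (hv : IsOptimal A B Q R P Cx cx Cu cu Ct ct N x v)
    (h : ∀ k < N, w k = v k) : IsOptimal A B Q R P Cx cx Cu cu Ct ct N x w :=
  ⟨hv.1.congr h, fun z hz => (cost_congr A B Q R P x h).trans_le (hv.2 z hz)⟩

theorem IsOptimal.unique (hQ : Q.PosSemidef) (hR : R.PosDef) (hP : P.PosSemidef)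
    (hv : IsOptimal A B Q R P Cx cx Cu cu Ct ct N x v)
    (hw : IsOptimal A B Q R P Cx cx Cu cu Ct ct N x w) : ∀ k < N, w k = v k := by
  have hmid : Feasible A B Cx cx Cu cu Ct ct N x (fun j => v j + (1 / 2 : ℝ) • (w j - v j)) := by
    refine ⟨fun k hk => ?_, ?_⟩
    · rw [traj_combo]
      exact ⟨mulVec_combo_le Cx (by norm_num) (by norm_num) (hv.1.1 k hk).1 (hw.1.1 k hk).1,
        mulVec_combo_le Cu (by norm_num) (by norm_num) (hv.1.1 k hk).2 (hw.1.1 k hk).2⟩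
    · rw [traj_combo]
      exact mulVec_combo_le Ct (by norm_num) (by norm_num) hv.1.2 hw.1.2
  have h1 := hv.2 _ hmid
  have h2 := hw.2 _ hmid
  rw [cost_combo] at h1 h2
  intro k hk
  have h3 : cost A B Q R P N 0 (fun j => w j - v j) ≤ 0 := by linarith
  exact sub_eq_zero.1 (input_eq_zero_of_cost_nonpos A B hQ hR hP h3 k hk)

/-- When the terminal constraints are inactive at the optimum, they can be dropped. -/
theorem IsOptimal.cost_le_of_terminal_inactive (hQ : Q.PosSemidef) (hR : R.PosDef)
    (hP : P.PosSemidef) (hv : IsOptimal A B Q R P Cx cx Cu cu Ct ct N x v)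
    (hN : ∀ r, (Ct *ᵥ traj A B x v N) r < ct r)
    (hw : ∀ k < N, Cx *ᵥ traj A B x w k ≤ cx ∧ Cu *ᵥ w k ≤ cu) :
    cost A B Q R P N x v ≤ cost A B Q R P N x w := by
  have hev : ∀ᶠ t : ℝ in nhdsWithin 0 (Set.Ioi 0), ∀ r,
      (Ct *ᵥ (traj A B x v N + t • (traj A B x w N - traj A B x v N))) r < ct r := by
    refine Filter.eventually_all.2 fun r => nhdsWithin_le_nhds ?_
    simp only [mulVec_add, mulVec_smul, Pi.add_apply, Pi.smul_apply, smul_eq_mul]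
    refine ContinuousAt.eventually_lt (by fun_prop) continuousAt_const ?_
    simpa using hN r
  have hsmall : ∀ᶠ t : ℝ in nhdsWithin 0 (Set.Ioi 0), t ∈ Set.Ioo (0 : ℝ) 1 :=
    Ioo_mem_nhdsGT one_pos
  obtain ⟨t, ht, ht0, ht1⟩ := (hev.and hsmall).exists
  have hfeas : Feasible A B Cx cx Cu cu Ct ct N x (fun j => v j + t • (w j - v j)) := by
    refine ⟨fun k hk => ?_, ?_⟩
    · rw [traj_combo]
      exact ⟨mulVec_combo_le Cx ht0.le ht1.le (hv.1.1 k hk).1 (hw k hk).1,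
        mulVec_combo_le Cu ht0.le ht1.le (hv.1.1 k hk).2 (hw k hk).2⟩
    · rw [traj_combo]
      exact fun r => (ht r).le
  have h1 := hv.2 _ hfeas
  rw [cost_combo] at h1
  have h2 : 0 ≤ t * (1 - t) * cost A B Q R P N 0 (fun j => w j - v j) :=
    mul_nonneg (mul_nonneg ht0.le (sub_nonneg.2 ht1.le)) (cost_nonneg A B hQ hR hP _ _ _)
  refine le_of_mul_le_mul_left ?_ ht0
  linarith

/-- Dropping the first input of an optimal sequence with inactive terminal constraints and
appending the terminal feedback gives an optimal sequence at the successor state. -/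
theorem IsOptimal.shift (hQ : Q.PosSemidef) (hR : R.PosDef) (hP : P.PosSemidef)
    {K : Matrix (Fin m) (Fin n) ℝ} (hdet : IsUnit (R + Bᵀ * P * B).det)
    (hRic : P = Aᵀ * (P - P * B * (R + Bᵀ * P * B)⁻¹ * (Bᵀ * P)) * A + Q)
    (hK : K = -((Bᵀ * P * B + R)⁻¹ * (Bᵀ * P * A)))
    (hTX : ∀ y, Ct *ᵥ y ≤ ct → Cx *ᵥ y ≤ cx ∧ Cu *ᵥ (K *ᵥ y) ≤ cu)
    (hTinv : ∀ y, Ct *ᵥ y ≤ ct → Ct *ᵥ ((A + B * K) *ᵥ y) ≤ ct)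
    (hNpos : 1 ≤ N) (hv : IsOptimal A B Q R P Cx cx Cu cu Ct ct N x v)
    (hN : ∀ r, (Ct *ᵥ traj A B x v N) r < ct r) (hvN : v N = K *ᵥ traj A B x v N) :
    IsOptimal A B Q R P Cx cx Cu cu Ct ct N (traj A B x v 1) (fun j => v (j + 1)) := by
  have hsq := riccati_complete_square A B hR hP hdet hRic hK
  refine ⟨⟨fun k hk => ?_, ?_⟩, fun w hw => ?_⟩
  · rw [traj_shift]
    rcases (Nat.succ_le_of_lt hk).lt_or_eq with h | h
    · exact hv.1.1 (k + 1) h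
    · have h' : k + 1 = N := h
      simpa only [h', hvN] using hTX _ hv.1.2
  · rw [traj_shift]
    have : traj A B x v (N + 1) = (A + B * K) *ᵥ traj A B x v N := by
      rw [traj, hvN, add_mulVec, mulVec_mulVec]
    rw [this]
    exact hTinv _ hv.1.2
  · let z : ℕ → Fin m → ℝ := fun j => Nat.casesOn j (v 0) w
    have hz1 : traj A B x z 1 = traj A B x v 1 := rfl
    have hztraj (k : ℕ) : traj A B x z (k + 1) = traj A B (traj A B x v 1) w k := by
      rw [← traj_shift, hz1]
    have hzfeas : ∀ k < N, Cx *ᵥ traj A B x z k ≤ cx ∧ Cu *ᵥ z k ≤ cu := by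
      rintro (_ | k) hk
      · exact hv.1.1 0 hNpos
      · rw [hztraj]
        exact hw.1 k (by omega)
    have h1 := hv.cost_le_of_terminal_inactive hQ hR hP hN hzfeas
    have h2 := cost_succ_left A B Q R P x v N
    have h3 : cost A B Q R P (N + 1) x z =
      (1 / 2) * (x ⬝ᵥ (Q *ᵥ x) + v 0 ⬝ᵥ (R *ᵥ v 0)) +
        cost A B Q R P N (traj A B x v 1) w := cost_succ_left A B Q R P x z N
    have h4 := cost_succ_right A B Q R P x v N
    have h5 := cost_succ_right A B Q R P x z N
    rw [traj, hsq, hvN, sub_self] at h4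
    rw [traj, hsq] at h5
    simp only [mulVec_zero, dotProduct_zero] at h4
    have h6 := input_form_nonneg hR (z N - K *ᵥ traj A B x z N)
    have h7 : 0 ≤ (B *ᵥ (z N - K *ᵥ traj A B x z N)) ⬝ᵥ
        (P *ᵥ (B *ᵥ (z N - K *ᵥ traj A B x z N))) := by
      simpa using hP.dotProduct_mulVec_nonneg (B *ᵥ (z N - K *ᵥ traj A B x z N))
    linarith

end Optimality

/-- A linear map preserving a polyhedron with `0` in its interior preserves the interior. -/
theorem mulVec_lt_of_invariant {n q : ℕ} {M : Matrix (Fin n) (Fin n) ℝ}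
    {C : Matrix (Fin q) (Fin n) ℝ} {c : Fin q → ℝ} (hc : ∀ r, 0 < c r)
    (hinv : ∀ y, C *ᵥ y ≤ c → C *ᵥ (M *ᵥ y) ≤ c) {y : Fin n → ℝ} (hy : ∀ r, (C *ᵥ y) r < c r) :
    ∀ r, (C *ᵥ (M *ᵥ y)) r < c r := by
  have hev : ∀ᶠ t : ℝ in nhdsWithin 1 (Set.Ioi 1), ∀ r, (C *ᵥ (t • y)) r < c r := by
    refine Filter.eventually_all.2 fun r => nhdsWithin_le_nhds ?_
    simp only [mulVec_smul, Pi.smul_apply, smul_eq_mul]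
    refine ContinuousAt.eventually_lt (by fun_prop) continuousAt_const ?_
    simpa using hy r
  obtain ⟨t, ht, ht1⟩ := (hev.and self_mem_nhdsWithin).exists
  have ht1 : 1 < t := ht1
  intro r
  have h1 := hinv (t • y) (fun r => (ht r).le) r
  simp only [mulVec_smul, Pi.smul_apply, smul_eq_mul] at h1
  have := hc r
  by_contra! hle
  nlinarith

/-- The extension of a control sequence by linear state feedback follows the closed loop. -/
theorem traj_extension {n m : ℕ} (A : Matrix (Fin n) (Fin n) ℝ) (B : Matrix (Fin n) (Fin m) ℝ)
    (K : Matrix (Fin m) (Fin n) ℝ) (x : Fin n → ℝ) {u v : ℕ → Fin m → ℝ} {N : ℕ}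
    (hv : v = fun k => if k < N then u k
      else K *ᵥ (((A + B * K) ^ (k - N)) *ᵥ traj A B x u N)) (j : ℕ) :
    traj A B x v (j + N) = ((A + B * K) ^ j) *ᵥ traj A B x u N := by
  induction j with
  | zero =>
    simpa using traj_congr A B x (v := v) (w := u) (fun k hk => by simp [hv, hk]) N le_rfl
  | succ j ih =>
    have hvj : v (j + N) = K *ᵥ (((A + B * K) ^ j) *ᵥ traj A B x u N) := by simp [hv]
    rw [Nat.add_right_comm, traj, ih, hvj, pow_succ', ← mulVec_mulVec _ (A + B * K),
      add_mulVec, ← mulVec_mulVec _ B]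

/-- on `ℙ_N`, the open-loop optimal input sequence coincides with the MPC input
sequence along the extended optimal trajectory, the trajectory stays in `ℙ_N`, and `ℙ_N`
is positive invariant under the MPC closed loop. -/
theorem stmt8
    {n m qX qU qT : ℕ}
    (A : Matrix (Fin n) (Fin n) ℝ) (B : Matrix (Fin n) (Fin m) ℝ)
    (Q : Matrix (Fin n) (Fin n) ℝ) (R : Matrix (Fin m) (Fin m) ℝ)
    (P : Matrix (Fin n) (Fin n) ℝ)
    (Cx : Matrix (Fin qX) (Fin n) ℝ) (cx : Fin qX → ℝ)
    (Cu : Matrix (Fin qU) (Fin m) ℝ) (cu : Fin qU → ℝ)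
    (Ct : Matrix (Fin qT) (Fin n) ℝ) (ct : Fin qT → ℝ)
    (hQ : Q.PosSemidef) (hR : R.PosDef) (hP : P.PosSemidef)
    (Kinf : Matrix (Fin m) (Fin n) ℝ)
    (hdet : IsUnit (R + Bᵀ * P * B).det)
    (hRic : P = Aᵀ * (P - P * B * (R + Bᵀ * P * B)⁻¹ * (Bᵀ * P)) * A + Q)
    (hK : Kinf = -((Bᵀ * P * B + R)⁻¹ * (Bᵀ * P * A)))
    (Xs : Set (Fin n → ℝ)) (hXs : Xs = {x | Cx *ᵥ x ≤ cx})
    (Us : Set (Fin m → ℝ)) (hUs : Us = {v | Cu *ᵥ v ≤ cu})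
    (Ts : Set (Fin n → ℝ)) (hTs : Ts = {x | Ct *ᵥ x ≤ ct})
    (XU : Set (Fin n → ℝ)) (hXU : XU = {x ∈ Xs | Kinf *ᵥ x ∈ Us})
    (hTchar : Ts = {x ∈ Xs | ∀ k : ℕ, ((A + B * Kinf) ^ k) *ᵥ x ∈ XU})
    (hXc : IsCompact Xs) (hUc : IsCompact Us) (hTc : IsCompact Ts)
    (hX0 : (0 : Fin n → ℝ) ∈ interior Xs)
    (hU0 : (0 : Fin m → ℝ) ∈ interior Us)
    (hT0 : (0 : Fin n → ℝ) ∈ interior Ts)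
    (hXint : interior Xs = {x | ∀ i, (Cx *ᵥ x) i < cx i})
    (hUint : interior Us = {v | ∀ j, (Cu *ᵥ v) j < cu j})
    (hTint : interior Ts = {x | ∀ r, (Ct *ᵥ x) r < ct r})
    (N : ℕ) (hN : 1 ≤ N)
    (PN : Set (Fin n → ℝ))
    (hPN : PN = {x | ∃ w, IsOptimal A B Q R P Cx cx Cu cu Ct ct N x w ∧ ∀ r, (Ct *ᵥ traj A B x w N) r < ct r})
    (uMPC : (Fin n → ℝ) → (Fin m → ℝ))
    (hMPC : ∀ x ∈ FeasSet A B Cx cx Cu cu Ct ct N, ∀ w, IsOptimal A B Q R P Cx cx Cu cu Ct ct N x w → uMPC x = w 0)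
    (x0 : Fin n → ℝ) (hx0 : x0 ∈ PN)
    (u : ℕ → Fin m → ℝ) (hu : IsOptimal A B Q R P Cx cx Cu cu Ct ct N x0 u)
    (uext : ℕ → Fin m → ℝ)
    (huext : uext = fun k => if k < N then u k
      else Kinf *ᵥ (((A + B * Kinf) ^ (k - N)) *ᵥ traj A B x0 u N)) :
    (∀ k : ℕ, traj A B x0 uext k ∈ PN ∧ uext k = uMPC (traj A B x0 uext k)) ∧
    (∀ x ∈ PN, A *ᵥ x + B *ᵥ uMPC x ∈ PN) := by
  have hXU_mem (y : Fin n → ℝ) : y ∈ XU ↔ Cx *ᵥ y ≤ cx ∧ Cu *ᵥ (Kinf *ᵥ y) ≤ cu := by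
    rw [hXU, hXs, hUs]
    rfl
  have hT_mem (y : Fin n → ℝ) :
      Ct *ᵥ y ≤ ct ↔ Cx *ᵥ y ≤ cx ∧ ∀ k : ℕ, ((A + B * Kinf) ^ k) *ᵥ y ∈ XU := by
    have := Set.ext_iff.1 hTchar y
    rwa [hTs, hXs] at this
  have hTX (y : Fin n → ℝ) (hy : Ct *ᵥ y ≤ ct) : Cx *ᵥ y ≤ cx ∧ Cu *ᵥ (Kinf *ᵥ y) ≤ cu := by
    have := ((hT_mem y).1 hy).2 0
    rwa [pow_zero, one_mulVec, hXU_mem] at this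
  have hTinv (y : Fin n → ℝ) (hy : Ct *ᵥ y ≤ ct) : Ct *ᵥ ((A + B * Kinf) *ᵥ y) ≤ ct := by
    have hpow := ((hT_mem y).1 hy).2
    refine (hT_mem _).2 ⟨?_, fun k => ?_⟩
    · have := hpow 1
      rw [pow_one, hXU_mem] at this
      exact this.1
    · rw [mulVec_mulVec, ← pow_succ]
      exact hpow (k + 1)
  have hct (r : Fin qT) : 0 < ct r := by
    rw [hTint] at hT0
    simpa using hT0 r
  have along (x : Fin n → ℝ) (w v : ℕ → Fin m → ℝ)
      (hw : IsOptimal A B Q R P Cx cx Cu cu Ct ct N x w)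
      (hwN : ∀ r, (Ct *ᵥ traj A B x w N) r < ct r)
      (hv : v = fun k => if k < N then w k
        else Kinf *ᵥ (((A + B * Kinf) ^ (k - N)) *ᵥ traj A B x w N)) (k : ℕ) :
      traj A B x v k ∈ PN ∧ v k = uMPC (traj A B x v k) := by
    have htail := traj_extension A B Kinf x hv
    have hfeedback (k : ℕ) : v (N + k) = Kinf *ᵥ traj A B x v (N + k) := by
      rw [Nat.add_comm N k, htail]
      simp [hv]
    have hstrict (k : ℕ) : ∀ r, (Ct *ᵥ traj A B x v (N + k)) r < ct r := by
      induction k with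
      | zero =>
        have := htail 0
        rw [Nat.zero_add, pow_zero, one_mulVec] at this
        rwa [Nat.add_zero, this]
      | succ k ih =>
        have : traj A B x v (N + (k + 1)) = (A + B * Kinf) *ᵥ traj A B x v (N + k) := by
          rw [← Nat.add_assoc, traj, hfeedback, add_mulVec, mulVec_mulVec]
        rw [this]
        exact mulVec_lt_of_invariant hct hTinv ih
    have hopt (k : ℕ) : IsOptimal A B Q R P Cx cx Cu cu Ct ct N (traj A B x v k)
        (fun i => v (i + k)) := by
      induction k with
      | zero => exact hw.congr fun k hk => by simp [hv, hk]
      | succ k ih =>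
        have h := ih.shift hQ hR hP hdet hRic hK hTX hTinv hN
          (by rw [traj_shift]; exact hstrict k) (by rw [traj_shift]; exact hfeedback k)
        rw [traj_shift, Nat.add_comm 1 k] at h
        simpa only [Nat.add_assoc, Nat.add_comm 1] using h
    refine ⟨?_, ?_⟩
    · rw [hPN]
      refine ⟨_, hopt k, ?_⟩
      rw [traj_shift]
      exact hstrict k
    · rw [hMPC _ ⟨_, (hopt k).1⟩ _ (hopt k), Nat.zero_add]
  refine ⟨?_, fun x hx => ?_⟩
  · rw [hPN] at hx0
    obtain ⟨w, hw, hwN⟩ := hx0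
    have huw := traj_congr A B x0 (hw.unique hQ hR hP hu) N le_rfl
    exact along x0 u uext hu (by rwa [huw]) huext
  · have hx' := hx
    rw [hPN] at hx'
    obtain ⟨w, hw, hwN⟩ := hx'
    have h := along x w _ hw hwN rfl
    have h0 := (h 0).2
    have h1 := (h 1).1
    rw [traj, h0] at h1
    exact h1
end
end

section
/- Let X ⊆ ℝ^n and U ⊆ ℝ^m be arbitrary sets, let K : ℝ^n → ℝ^m and F : ℝ^n → ℝ^n be linear maps, and define X_U = {x ∈ X : Kx ∈ U} and T = {x ∈ X : F^k x ∈ X_U for all k ≥ 0}. If x ∈ int X, Kx ∈ int U, and Fx ∈ int T, then x ∈ int T. -/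
open Set

/-- with `X_U = {x ∈ X | Kx ∈ U}` and `T = {x ∈ X | F^k x ∈ X_U ∀ k}`,
`x ∈ int X`, `Kx ∈ int U` and `Fx ∈ int T` imply `x ∈ int T`. -/
theorem stmt12 {n m : ℕ} (X : Set (Fin n → ℝ)) (U : Set (Fin m → ℝ))
    (K : (Fin n → ℝ) →ₗ[ℝ] (Fin m → ℝ)) (F : Module.End ℝ (Fin n → ℝ))
    (XU T : Set (Fin n → ℝ))
    (hXU : XU = {x ∈ X | K x ∈ U})
    (hT : T = {x ∈ X | ∀ k : ℕ, (F ^ k) x ∈ XU})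
    (x : Fin n → ℝ) (hx : x ∈ interior X) (hKx : K x ∈ interior U)
    (hFx : F x ∈ interior T) :
    x ∈ interior T := by
  have hK : Continuous K := K.continuous_of_finiteDimensional
  have hF : Continuous F := LinearMap.continuous_of_finiteDimensional F
  rw [mem_interior_iff_mem_nhds] at *
  filter_upwards [hx, hK.continuousAt.preimage_mem_nhds hKx,
    hF.continuousAt.preimage_mem_nhds hFx] with y hyX hyU hyT
  subst hT hXU
  refine ⟨hyX, fun k => ?_⟩
  cases k with
  | zero => exact ⟨hyX, hyU⟩
  | succ k =>
    rw [pow_succ, Module.End.mul_apply]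
    exact hyT.2 k
end

section
/- For every x0 ∈ T and every horizon N ≥ 1, the LQR input sequence u(k) = K∞ (A + B K∞)^k x0, 0 ≤ k ≤ N−1, is feasible for the horizon-N constrained problem, it is the unique optimal sequence, and the optimal value is J_N(x0,u) = ½ x0ᵀ P x0. In particular, on T the solution of the constrained finite-horizon problem coincides with the unconstrained LQR feedback solution for every horizon. -/
open Matrix Set

noncomputable section

/-- The terms of a sum of two quadratic forms along `A x + B u` recombine by completing the square
in `u`. -/
theorem complete_square {n m : ℕ} {A : Matrix (Fin n) (Fin n) ℝ} {B : Matrix (Fin n) (Fin m) ℝ}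
    {Q : Matrix (Fin n) (Fin n) ℝ} {R : Matrix (Fin m) (Fin m) ℝ}
    {P : Matrix (Fin n) (Fin n) ℝ} {K : Matrix (Fin m) (Fin n) ℝ}
    (hR : Rᵀ = R) (hP : Pᵀ = P)
    (hK : (R + Bᵀ * P * B) * K = -(Bᵀ * P * A))
    (hRic : P = Aᵀ * P * A + Aᵀ * P * B * K + Q) (x : Fin n → ℝ) (u : Fin m → ℝ) :
    (A *ᵥ x + B *ᵥ u) ⬝ᵥ (P *ᵥ (A *ᵥ x + B *ᵥ u)) + (x ⬝ᵥ (Q *ᵥ x) + u ⬝ᵥ (R *ᵥ u)) =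
      x ⬝ᵥ (P *ᵥ x) + (u - K *ᵥ x) ⬝ᵥ ((R + Bᵀ * P * B) *ᵥ (u - K *ᵥ x)) := by
  have hcross : Aᵀ * P * B = -(Kᵀ * (R + Bᵀ * P * B)) := by
    have h := congrArg Matrix.transpose hK
    simp only [transpose_mul, transpose_add, transpose_neg, transpose_transpose, hR, hP] at h
    rw [← Matrix.mul_assoc, ← Matrix.mul_assoc] at h
    rw [h, neg_neg]
  have hQx : x ⬝ᵥ (P *ᵥ x) = x ⬝ᵥ ((Aᵀ * P * A) *ᵥ x)
      + x ⬝ᵥ ((Aᵀ * P * B * K) *ᵥ x) + x ⬝ᵥ (Q *ᵥ x) := by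
    conv_lhs => rw [hRic]
    simp only [add_mulVec, dotProduct_add]
  have hKK : x ⬝ᵥ ((Aᵀ * P * B * K) *ᵥ x) = -(x ⬝ᵥ ((Kᵀ * (R + Bᵀ * P * B) * K) *ᵥ x)) := by
    rw [hcross, Matrix.neg_mul, neg_mulVec, dotProduct_neg]
  have hxu : x ⬝ᵥ ((Aᵀ * P * B) *ᵥ u) = -(x ⬝ᵥ ((Kᵀ * (R + Bᵀ * P * B)) *ᵥ u)) := by
    rw [hcross, neg_mulVec, dotProduct_neg]
  have hux : u ⬝ᵥ ((Bᵀ * P * A) *ᵥ x) = -(u ⬝ᵥ (((R + Bᵀ * P * B) * K) *ᵥ x)) := by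
    rw [hK, neg_mulVec, dotProduct_neg, neg_neg]
  have move {p q : ℕ} (C : Matrix (Fin p) (Fin q) ℝ) (y : Fin q → ℝ) (z : Fin p → ℝ) :
      (C *ᵥ y) ⬝ᵥ z = y ⬝ᵥ (Cᵀ *ᵥ z) := by
    rw [dotProduct_mulVec, vecMul_transpose]
  have huu : u ⬝ᵥ ((R + Bᵀ * P * B) *ᵥ u) = u ⬝ᵥ (R *ᵥ u) + u ⬝ᵥ ((Bᵀ * P * B) *ᵥ u) := by
    rw [add_mulVec, dotProduct_add]
  generalize R + Bᵀ * P * B = M at *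
  simp only [mulVec_add, mulVec_sub, add_dotProduct, sub_dotProduct, dotProduct_add,
    dotProduct_sub, move, mulVec_mulVec, ← Matrix.mul_assoc] at *
  linarith

/-- The cost is the quadratic form of the Riccati solution at the initial state plus the weighted
squared deviations from the feedback law. -/
theorem cost_eq_add_sum {n m : ℕ} {A : Matrix (Fin n) (Fin n) ℝ} {B : Matrix (Fin n) (Fin m) ℝ}
    {Q : Matrix (Fin n) (Fin n) ℝ} {R : Matrix (Fin m) (Fin m) ℝ}
    {P : Matrix (Fin n) (Fin n) ℝ} {K : Matrix (Fin m) (Fin n) ℝ}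
    (hR : Rᵀ = R) (hP : Pᵀ = P)
    (hK : (R + Bᵀ * P * B) * K = -(Bᵀ * P * A))
    (hRic : P = Aᵀ * P * A + Aᵀ * P * B * K + Q)
    (N : ℕ) (x0 : Fin n → ℝ) (u : ℕ → Fin m → ℝ) :
    cost A B Q R P N x0 u = (1 / 2) * (x0 ⬝ᵥ (P *ᵥ x0)) +
      (1 / 2) * ∑ k ∈ Finset.range N, (u k - K *ᵥ traj A B x0 u k) ⬝ᵥ
        ((R + Bᵀ * P * B) *ᵥ (u k - K *ᵥ traj A B x0 u k)) := by
  induction N with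
  | zero => simp [cost, traj]
  | succ N ih =>
    have h := complete_square hR hP hK hRic (traj A B x0 u N) (u N)
    simp only [cost, traj, Finset.sum_range_succ] at ih ⊢
    linarith

/-- Following the feedback law up to time `N` produces the closed-loop trajectory. -/
theorem traj_eq_of_feedback {n m : ℕ} {A : Matrix (Fin n) (Fin n) ℝ}
    {B : Matrix (Fin n) (Fin m) ℝ} {K : Matrix (Fin m) (Fin n) ℝ} {x0 : Fin n → ℝ}
    {u : ℕ → Fin m → ℝ} {N : ℕ} (hu : ∀ k < N, u k = K *ᵥ traj A B x0 u k) :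
    ∀ k ≤ N, traj A B x0 u k = ((A + B * K) ^ k) *ᵥ x0 := by
  intro k
  induction k with
  | zero => simp [traj]
  | succ k ih =>
    intro hk
    rw [traj, hu k hk, ih (by omega), pow_succ', ← mulVec_mulVec, add_mulVec, mulVec_mulVec _ B]

/-- The closed-loop input sequence produces the closed-loop trajectory. -/
theorem traj_closedLoop {n m : ℕ} (A : Matrix (Fin n) (Fin n) ℝ)
    (B : Matrix (Fin n) (Fin m) ℝ) (K : Matrix (Fin m) (Fin n) ℝ) (x0 : Fin n → ℝ) (k : ℕ) :
    traj A B x0 (fun j => K *ᵥ (((A + B * K) ^ j) *ᵥ x0)) k = ((A + B * K) ^ k) *ᵥ x0 := by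
  induction k with
  | zero => simp [traj]
  | succ k ih =>
    rw [traj, ih, pow_succ', ← mulVec_mulVec, add_mulVec, mulVec_mulVec _ B]

/-- on `T` the constrained finite-horizon problem is solved by the unconstrained
LQR feedback for every horizon, uniquely, with optimal value `½ x0ᵀ P x0`. -/
theorem stmt15
    {n m qX qU qT : ℕ}
    (A : Matrix (Fin n) (Fin n) ℝ) (B : Matrix (Fin n) (Fin m) ℝ)
    (Q : Matrix (Fin n) (Fin n) ℝ) (R : Matrix (Fin m) (Fin m) ℝ)
    (P : Matrix (Fin n) (Fin n) ℝ)
    (Cx : Matrix (Fin qX) (Fin n) ℝ) (cx : Fin qX → ℝ)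
    (Cu : Matrix (Fin qU) (Fin m) ℝ) (cu : Fin qU → ℝ)
    (Ct : Matrix (Fin qT) (Fin n) ℝ) (ct : Fin qT → ℝ)
    (hQ : Q.PosSemidef) (hR : R.PosDef) (hP : P.PosSemidef)
    (Kinf : Matrix (Fin m) (Fin n) ℝ)
    (hdet : IsUnit (R + Bᵀ * P * B).det)
    (hRic : P = Aᵀ * (P - P * B * (R + Bᵀ * P * B)⁻¹ * (Bᵀ * P)) * A + Q)
    (hK : Kinf = -((Bᵀ * P * B + R)⁻¹ * (Bᵀ * P * A)))
    (Xs : Set (Fin n → ℝ)) (hXs : Xs = {x | Cx *ᵥ x ≤ cx})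
    (Us : Set (Fin m → ℝ)) (hUs : Us = {v | Cu *ᵥ v ≤ cu})
    (Ts : Set (Fin n → ℝ)) (hTs : Ts = {x | Ct *ᵥ x ≤ ct})
    (XU : Set (Fin n → ℝ)) (hXU : XU = {x ∈ Xs | Kinf *ᵥ x ∈ Us})
    (hTchar : Ts = {x ∈ Xs | ∀ k : ℕ, ((A + B * Kinf) ^ k) *ᵥ x ∈ XU})
    (x0 : Fin n → ℝ) (hx0 : x0 ∈ Ts) (N : ℕ) (hN : 1 ≤ N)
    (uLQR : ℕ → Fin m → ℝ)
    (huLQR : uLQR = fun k => Kinf *ᵥ (((A + B * Kinf) ^ k) *ᵥ x0)) :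
    Feasible A B Cx cx Cu cu Ct ct N x0 uLQR ∧
    IsOptimal A B Q R P Cx cx Cu cu Ct ct N x0 uLQR ∧
    (∀ v, IsOptimal A B Q R P Cx cx Cu cu Ct ct N x0 v → ∀ k < N, v k = uLQR k) ∧
    cost A B Q R P N x0 uLQR = (1 / 2) * (x0 ⬝ᵥ (P *ᵥ x0)) := by
  have hRt : Rᵀ = R := by simpa using hR.isHermitian.eq
  have hPt : Pᵀ = P := by simpa using hP.isHermitian.eq
  have hM : (R + Bᵀ * P * B).PosDef := by
    refine hR.add_posSemidef ?_
    simpa using hP.conjTranspose_mul_mul_same B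
  have hMK : (R + Bᵀ * P * B) * Kinf = -(Bᵀ * P * A) := by
    rw [hK, add_comm (Bᵀ * P * B) R, Matrix.mul_neg, mul_nonsing_inv_cancel_left _ _ hdet]
  have hRic' : P = Aᵀ * P * A + Aᵀ * P * B * Kinf + Q := by
    conv_lhs => rw [hRic]
    rw [hK, add_comm (Bᵀ * P * B) R]
    simp only [Matrix.mul_sub, Matrix.sub_mul, Matrix.mul_neg, Matrix.mul_assoc]
    rw [sub_eq_add_neg]
  have hcost := cost_eq_add_sum hRt hPt hMK hRic' N x0
  have htraj : ∀ k, traj A B x0 uLQR k = ((A + B * Kinf) ^ k) *ᵥ x0 := by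
    rw [huLQR]; exact traj_closedLoop A B Kinf x0
  have hinv : ∀ k, ((A + B * Kinf) ^ k) *ᵥ x0 ∈ XU := by
    rw [hTchar] at hx0; exact hx0.2
  have hXU' : ∀ y ∈ XU, Cx *ᵥ y ≤ cx ∧ Cu *ᵥ (Kinf *ᵥ y) ≤ cu := by
    intro y hy
    simpa [hXU, hXs, hUs] using hy
  have hterm : ((A + B * Kinf) ^ N) *ᵥ x0 ∈ Ts := by
    have hN' := hinv N
    rw [hTchar]
    refine ⟨?_, fun k => ?_⟩
    · rw [hXU] at hN'; exact hN'.1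
    · rw [mulVec_mulVec, ← pow_add]; exact hinv _
  have hfeas : Feasible A B Cx cx Cu cu Ct ct N x0 uLQR := by
    refine ⟨fun k _ => ?_, ?_⟩
    · rw [htraj, huLQR]; exact hXU' _ (hinv k)
    · rw [htraj]; simpa [hTs] using hterm
  have hval : cost A B Q R P N x0 uLQR = (1 / 2) * (x0 ⬝ᵥ (P *ᵥ x0)) := by
    rw [hcost]
    simp only [htraj]
    simp [huLQR]
  have hnonneg (y : Fin m → ℝ) : 0 ≤ y ⬝ᵥ ((R + Bᵀ * P * B) *ᵥ y) := by
    simpa using hM.posSemidef.dotProduct_mulVec_nonneg y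
  refine ⟨hfeas, ⟨hfeas, fun v _ => ?_⟩, fun v hv => ?_, hval⟩
  · rw [hval, hcost v]
    have := Finset.sum_nonneg (s := Finset.range N)
      fun k _ => hnonneg (v k - Kinf *ᵥ traj A B x0 v k)
    linarith
  · have hle := hv.2 _ hfeas
    rw [hval, hcost v] at hle
    have hsum := le_antisymm (by linarith) (Finset.sum_nonneg (s := Finset.range N)
      fun k _ => hnonneg (v k - Kinf *ᵥ traj A B x0 v k))
    rw [Finset.sum_eq_zero_iff_of_nonneg fun k _ => hnonneg _] at hsum
    have hfb : ∀ k < N, v k = Kinf *ᵥ traj A B x0 v k := by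
      intro k hk
      by_contra hne
      have hpos := hM.dotProduct_mulVec_pos (sub_ne_zero.mpr hne)
      rw [star_trivial, hsum k (Finset.mem_range.mpr hk)] at hpos
      exact lt_irrefl _ hpos
    intro k hk
    rw [hfb k hk, traj_eq_of_feedback hfb k hk.le, huLQR]
end
end
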